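/- Assume the identity matrix I_n together with A_1, …, A_m are linearly independent. Then the map Φ : ℝ^m → ℝ^m defined by Φ(y) := 𝒜(exp(A(y)) / tr(exp(A(y)))) is injective and its range is exactly the interior of the moment body ℳ; that is, Φ is a bijection from ℝ^m onto interior ℳ. -/

import Mathlib

open Matrix Filter
open scoped RealInnerProductSpace

/-- `A(y) = ∑ i, y i • A i`. -/
noncomputable def matA {n m : ℕ} (A : Fin m → Matrix (Fin n) (Fin n) ℝ)
    (y : EuclideanSpace ℝ (Fin m)) : Matrix (Fin n) (Fin n) ℝ :=
  ∑ i, y i • A i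

/-- The log-partition function `f(y) = log tr exp A(y) - ⟨b, y⟩`. -/
noncomputable def logPart {n m : ℕ} (A : Fin m → Matrix (Fin n) (Fin n) ℝ)
    (b : EuclideanSpace ℝ (Fin m)) (y : EuclideanSpace ℝ (Fin m)) : ℝ :=
  Real.log (Matrix.trace (NormedSpace.exp (matA A y))) - ⟪b, y⟫

/-- The linear map `𝒜(X) = (tr(A i * X))_i`. -/
noncomputable def Amap {n m : ℕ} (A : Fin m → Matrix (Fin n) (Fin n) ℝ)
    (X : Matrix (Fin n) (Fin n) ℝ) : EuclideanSpace ℝ (Fin m) :=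
  WithLp.toLp 2 (fun i => Matrix.trace (A i * X))

/-- The spectraplex: symmetric PSD matrices of unit trace. -/
def spectraplex (n : ℕ) : Set (Matrix (Fin n) (Fin n) ℝ) :=
  {X | X.IsSymm ∧ X.PosSemidef ∧ X.trace = 1}

/-- The moment body `ℳ = 𝒜(spectraplex)`. -/
noncomputable def momentBody {n m : ℕ} (A : Fin m → Matrix (Fin n) (Fin n) ℝ) :
    Set (EuclideanSpace ℝ (Fin m)) :=
  Amap A '' spectraplex n

/-- The trace-normalized matrix exponential `X(y)`. -/
noncomputable def densityMat {n m : ℕ} (A : Fin m → Matrix (Fin n) (Fin n) ℝ)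
    (y : EuclideanSpace ℝ (Fin m)) : Matrix (Fin n) (Fin n) ℝ :=
  (Matrix.trace (NormedSpace.exp (matA A y)))⁻¹ • NormedSpace.exp (matA A y)

section TraceExponential

variable {ι : Type*} [Fintype ι] [DecidableEq ι]

lemma exists_orthogonal_diagonalization {H : Matrix ι ι ℝ} (hH : H.IsSymm) :
    ∃ (U : Matrix ι ι ℝ) (a : ι → ℝ), U * Uᵀ = 1 ∧ Uᵀ * U = 1 ∧ H = U * diagonal a * Uᵀ := by
  have hH' : H.IsHermitian := by
    rw [IsHermitian, conjTranspose_eq_transpose_of_trivial]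
    exact hH
  refine ⟨hH'.eigenvectorUnitary, hH'.eigenvalues, ?_, ?_, ?_⟩
  · simpa [star_eq_conjTranspose] using Unitary.coe_mul_star_self hH'.eigenvectorUnitary
  · simpa [star_eq_conjTranspose] using Unitary.coe_star_mul_self hH'.eigenvectorUnitary
  · have h := hH'.spectral_theorem
    rw [Unitary.conjStarAlgAut_apply] at h
    simpa [star_eq_conjTranspose, Function.comp_def] using h

lemma exp_orthogonal_conj_diagonal {U : Matrix ι ι ℝ} (hU : U * Uᵀ = 1) (a : ι → ℝ) :
    NormedSpace.exp (U * diagonal a * Uᵀ) = U * diagonal (fun i => Real.exp (a i)) * Uᵀ := by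
  have hinv : U⁻¹ = Uᵀ := inv_eq_right_inv hU
  have hunit : IsUnit U := IsUnit.of_mul_eq_one _ hU
  rw [← hinv, Matrix.exp_conj _ _ hunit, Matrix.exp_diagonal]
  congr 3
  ext i
  rw [Pi.coe_exp, Real.exp_eq_exp_ℝ]

lemma trace_orthogonal_conj_diagonal_mul (U V : Matrix ι ι ℝ) (a b : ι → ℝ) :
    trace (U * diagonal a * Uᵀ * (V * diagonal b * Vᵀ)) =
      ∑ i, ∑ j, (Uᵀ * V) i j ^ 2 * (a i * b j) := by
  have h : U * diagonal a * Uᵀ * (V * diagonal b * Vᵀ) =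
      U * (diagonal a * (Uᵀ * V) * diagonal b * Vᵀ) := by
    simp only [Matrix.mul_assoc]
  have h' : diagonal a * (Uᵀ * V) * diagonal b * Vᵀ * U =
      diagonal a * (Uᵀ * V) * diagonal b * (Uᵀ * V)ᵀ := by
    simp only [transpose_mul, transpose_transpose, Matrix.mul_assoc]
  rw [h, trace_mul_comm, h', trace]
  refine Finset.sum_congr rfl fun i _ => ?_
  rw [diag_apply, Matrix.mul_apply]
  refine Finset.sum_congr rfl fun j _ => ?_
  rw [mul_diagonal, diagonal_mul, transpose_apply]
  ring

lemma exp_mul_sub_lt_exp_sub_exp {x y : ℝ} (h : x ≠ y) :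
    Real.exp y * (x - y) < Real.exp x - Real.exp y := by
  have h1 := Real.add_one_lt_exp (sub_ne_zero.2 h)
  have h2 : Real.exp x = Real.exp y * Real.exp (x - y) := by
    rw [← Real.exp_add]
    ring_nf
  rw [h2]
  nlinarith [Real.exp_pos y]

lemma exp_mul_sub_le_exp_sub_exp (x y : ℝ) :
    Real.exp y * (x - y) ≤ Real.exp x - Real.exp y := by
  rcases eq_or_ne x y with rfl | h
  · simp
  · exact (exp_mul_sub_lt_exp_sub_exp h).le

/-- The **Klein inequality** for the exponential, with its equality case. -/
lemma klein_inequality_exp {H K : Matrix ι ι ℝ} (hH : H.IsSymm) (hK : K.IsSymm) :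
    trace ((H - K) * NormedSpace.exp K) ≤
        trace (NormedSpace.exp H) - trace (NormedSpace.exp K) ∧
      (trace (NormedSpace.exp H) - trace (NormedSpace.exp K) ≤
        trace ((H - K) * NormedSpace.exp K) → H = K) := by
  obtain ⟨U, a, hU, hU', rfl⟩ := exists_orthogonal_diagonalization hH
  obtain ⟨V, b, hV, hV', rfl⟩ := exists_orthogonal_diagonalization hK
  rw [exp_orthogonal_conj_diagonal hU, exp_orthogonal_conj_diagonal hV]
  have hone : ∀ W : Matrix ι ι ℝ, W * Wᵀ = 1 → W * diagonal (fun _ => (1 : ℝ)) * Wᵀ = 1 := by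
    intro W hW
    rw [diagonal_one, Matrix.mul_one, hW]
  have hsq : V * diagonal b * Vᵀ * (V * diagonal (fun j => Real.exp (b j)) * Vᵀ) =
      V * diagonal (fun j => b j * Real.exp (b j)) * Vᵀ := by
    rw [← diagonal_mul_diagonal]
    calc _ = V * diagonal b * (Vᵀ * V) * diagonal (fun j => Real.exp (b j)) * Vᵀ := by
          simp only [Matrix.mul_assoc]
      _ = _ := by rw [hV', Matrix.mul_one]; simp only [Matrix.mul_assoc]
  have hH1 := trace_orthogonal_conj_diagonal_mul U V (fun i => Real.exp (a i)) (fun _ => 1)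
  have hK1 := trace_orthogonal_conj_diagonal_mul U V (fun _ => 1) (fun j => Real.exp (b j))
  have hK2 := trace_orthogonal_conj_diagonal_mul U V (fun _ => 1)
    (fun j => b j * Real.exp (b j))
  rw [hone V hV, Matrix.mul_one] at hH1
  rw [hone U hU, Matrix.one_mul] at hK1 hK2
  have key : trace (U * diagonal (fun i => Real.exp (a i)) * Uᵀ) -
      trace (V * diagonal (fun j => Real.exp (b j)) * Vᵀ) -
      trace ((U * diagonal a * Uᵀ - V * diagonal b * Vᵀ) *
        (V * diagonal (fun j => Real.exp (b j)) * Vᵀ)) =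
      ∑ i, ∑ j, (Uᵀ * V) i j ^ 2 *
        (Real.exp (a i) - Real.exp (b j) - Real.exp (b j) * (a i - b j)) := by
    rw [Matrix.sub_mul, trace_sub, hsq, trace_orthogonal_conj_diagonal_mul, hH1, hK1, hK2]
    simp only [← Finset.sum_sub_distrib]
    refine Finset.sum_congr rfl fun i _ => Finset.sum_congr rfl fun j _ => ?_
    ring
  have hterm : ∀ i j, 0 ≤ (Uᵀ * V) i j ^ 2 *
      (Real.exp (a i) - Real.exp (b j) - Real.exp (b j) * (a i - b j)) := fun i j =>
    mul_nonneg (sq_nonneg _) (sub_nonneg.2 (exp_mul_sub_le_exp_sub_exp _ _))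
  have hsum := Finset.sum_nonneg fun i (_ : i ∈ Finset.univ) =>
    Finset.sum_nonneg fun j (_ : j ∈ Finset.univ) => hterm i j
  refine ⟨by linarith, fun hle => ?_⟩
  have hzero : ∀ i j, (Uᵀ * V) i j ^ 2 *
      (Real.exp (a i) - Real.exp (b j) - Real.exp (b j) * (a i - b j)) = 0 := by
    have h0 := le_antisymm (by linarith) hsum
    intro i j
    rw [Finset.sum_eq_zero_iff_of_nonneg
      fun i _ => Finset.sum_nonneg fun j _ => hterm i j] at h0
    have h1 := h0 i (Finset.mem_univ i)
    rw [Finset.sum_eq_zero_iff_of_nonneg fun j _ => hterm i j] at h1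
    exact h1 j (Finset.mem_univ j)
  have hcomm : diagonal a * (Uᵀ * V) = (Uᵀ * V) * diagonal b := by
    ext i j
    rw [diagonal_mul, mul_diagonal]
    rcases eq_or_ne (a i) (b j) with h | h
    · rw [h, mul_comm]
    · rcases mul_eq_zero.1 (hzero i j) with h' | h'
      · rw [pow_eq_zero_iff two_ne_zero] at h'
        rw [h']
        ring
      · linarith [exp_mul_sub_lt_exp_sub_exp h]
  calc U * diagonal a * Uᵀ = U * (diagonal a * (Uᵀ * V)) * Vᵀ := by
        rw [← Matrix.mul_one Uᵀ, ← hV]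
        simp only [Matrix.mul_assoc, hV', Matrix.mul_one]
    _ = (U * Uᵀ) * V * diagonal b * Vᵀ := by
        rw [hcomm]
        simp only [Matrix.mul_assoc]
    _ = V * diagonal b * Vᵀ := by rw [hU, Matrix.one_mul]

lemma trace_exp_pos [Nonempty ι] {H : Matrix ι ι ℝ} (hH : H.IsSymm) :
    0 < trace (NormedSpace.exp H) := by
  obtain ⟨U, a, hU, hU', rfl⟩ := exists_orthogonal_diagonalization hH
  rw [exp_orthogonal_conj_diagonal hU, trace_mul_comm, ← Matrix.mul_assoc, hU', Matrix.one_mul,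
    trace_diagonal]
  exact Finset.sum_pos (fun i _ => Real.exp_pos _) Finset.univ_nonempty

lemma posSemidef_exp {H : Matrix ι ι ℝ} (hH : H.IsSymm) : (NormedSpace.exp H).PosSemidef := by
  obtain ⟨U, a, hU, -, rfl⟩ := exists_orthogonal_diagonalization hH
  rw [exp_orthogonal_conj_diagonal hU]
  simpa using (PosSemidef.diagonal (d := fun i => Real.exp (a i))
    fun i => (Real.exp_pos _).le).mul_mul_conjTranspose_same U

lemma exp_add_smul_one (H : Matrix ι ι ℝ) (c : ℝ) :
    NormedSpace.exp (H + c • (1 : Matrix ι ι ℝ)) = Real.exp c • NormedSpace.exp H := by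
  rw [Matrix.exp_add_of_commute _ _ ((Commute.one_right H).smul_right c),
    smul_one_eq_diagonal, Matrix.exp_diagonal]
  have : NormedSpace.exp (fun _ : ι => c) = fun _ => Real.exp c := by
    ext i
    rw [Pi.coe_exp, Real.exp_eq_exp_ℝ]
  rw [this, ← smul_one_eq_diagonal, Matrix.mul_smul, Matrix.mul_one]

/-- Tangent inequality for the convex function `H ↦ log tr exp H`, with its equality case. -/
lemma trace_smul_exp_le_log_trace_exp_sub [Nonempty ι] {H K : Matrix ι ι ℝ}
    (hH : H.IsSymm) (hK : K.IsSymm) :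
    trace ((H - K) * ((trace (NormedSpace.exp K))⁻¹ • NormedSpace.exp K)) ≤
        Real.log (trace (NormedSpace.exp H)) - Real.log (trace (NormedSpace.exp K)) ∧
      (Real.log (trace (NormedSpace.exp H)) - Real.log (trace (NormedSpace.exp K)) ≤
        trace ((H - K) * ((trace (NormedSpace.exp K))⁻¹ • NormedSpace.exp K)) →
        ∃ c : ℝ, H - K = c • 1) := by
  have hZH := trace_exp_pos hH
  have hZK := trace_exp_pos hK
  set ZH := trace (NormedSpace.exp H) with hZHdef
  set ZK := trace (NormedSpace.exp K) with hZKdef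
  set c := Real.log ZK - Real.log ZH with hc
  have hsymm : (H + c • (1 : Matrix ι ι ℝ)).IsSymm := hH.add (isSymm_one.smul c)
  have hZ : trace (NormedSpace.exp (H + c • (1 : Matrix ι ι ℝ))) = ZK := by
    rw [exp_add_smul_one, trace_smul, ← hZHdef, hc, Real.exp_sub, Real.exp_log hZH,
      Real.exp_log hZK, smul_eq_mul]
    field_simp
  obtain ⟨h1, h2⟩ := klein_inequality_exp hsymm hK
  have htr : trace ((H + c • (1 : Matrix ι ι ℝ) - K) * NormedSpace.exp K) =
      trace ((H - K) * NormedSpace.exp K) + c * ZK := by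
    rw [add_sub_right_comm, Matrix.add_mul, trace_add, smul_mul, Matrix.one_mul, trace_smul,
      smul_eq_mul]
  rw [hZ, ← hZKdef, sub_self, htr] at h1 h2
  rw [Matrix.mul_smul, trace_smul, smul_eq_mul, inv_mul_eq_div, div_le_iff₀ hZK, le_div_iff₀ hZK]
  refine ⟨by rw [hc] at h1; linarith, fun h => ⟨-c, ?_⟩⟩
  rw [← h2 (by rw [hc]; linarith), neg_smul]
  abel

/-- **Gibbs variational inequality**. -/
lemma trace_mul_le_log_trace_exp [Nonempty ι] {H X : Matrix ι ι ℝ} (hH : H.IsSymm)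
    (hX : X.PosSemidef) (hX1 : X.trace = 1) :
    trace (H * X) ≤ Real.log (trace (NormedSpace.exp H)) := by
  rw [Real.le_log_iff_exp_le (trace_exp_pos hH)]
  obtain ⟨U, a, hU, hU', rfl⟩ := exists_orthogonal_diagonalization hH
  rw [exp_orthogonal_conj_diagonal hU]
  set P := Uᵀ * X * U with hP
  have hPpos : ∀ i, 0 ≤ P i i := fun i => by
    simpa [hP] using (hX.conjTranspose_mul_mul_same U).diag_nonneg (i := i)
  have hPtr : ∑ i, P i i = 1 := by
    change trace P = 1
    rw [hP, trace_mul_comm, ← Matrix.mul_assoc, hU, Matrix.one_mul, hX1]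
  have htr : trace (U * diagonal a * Uᵀ * X) = ∑ i, P i i • a i := by
    rw [Matrix.mul_assoc, Matrix.mul_assoc, trace_mul_comm, Matrix.mul_assoc, ← hP, trace]
    simp [mul_comm]
  have htr' : trace (U * diagonal (fun i => Real.exp (a i)) * Uᵀ) = ∑ i, Real.exp (a i) := by
    rw [trace_mul_comm, ← Matrix.mul_assoc, hU', Matrix.one_mul, trace_diagonal]
  rw [htr, htr']
  refine (convexOn_exp.map_sum_le (fun i _ => hPpos i) hPtr fun i _ => Set.mem_univ _).trans
    (Finset.sum_le_sum fun i _ => ?_)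
  have : P i i ≤ 1 := hPtr ▸ Finset.single_le_sum (fun j _ => hPpos j) (Finset.mem_univ i)
  exact mul_le_of_le_one_left (Real.exp_pos _).le this

end TraceExponential

open scoped Matrix.Norms.Operator in
lemma continuous_matrix_exp {ι : Type*} [Fintype ι] [DecidableEq ι] :
    Continuous (NormedSpace.exp : Matrix ι ι ℝ → Matrix ι ι ℝ) :=
  NormedSpace.exp_continuous

section MomentMap

variable {n m : ℕ} {A : Fin m → Matrix (Fin n) (Fin n) ℝ}

lemma inner_Amap (A : Fin m → Matrix (Fin n) (Fin n) ℝ) (X : Matrix (Fin n) (Fin n) ℝ)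
    (y : EuclideanSpace ℝ (Fin m)) : ⟪Amap A X, y⟫ = trace (matA A y * X) := by
  simp [Amap, matA, PiLp.inner_apply, Finset.sum_mul, trace_sum]

lemma matA_sub (A : Fin m → Matrix (Fin n) (Fin n) ℝ) (y z : EuclideanSpace ℝ (Fin m)) :
    matA A y - matA A z = matA A (y - z) := by
  simp [matA, sub_smul]

lemma isSymm_matA (hA : ∀ i, (A i)ᵀ = A i) (y : EuclideanSpace ℝ (Fin m)) :
    (matA A y).IsSymm := by
  simp [IsSymm, matA, transpose_sum, hA]

lemma continuous_matA (A : Fin m → Matrix (Fin n) (Fin n) ℝ) : Continuous (matA A) := by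
  unfold matA
  fun_prop

lemma continuous_exp_matA (A : Fin m → Matrix (Fin n) (Fin n) ℝ) :
    Continuous fun y => NormedSpace.exp (matA A y) :=
  continuous_matrix_exp.comp (continuous_matA A)

variable [Nonempty (Fin n)]

lemma continuous_Amap_densityMat (hA : ∀ i, (A i)ᵀ = A i) :
    Continuous fun y => Amap A (densityMat A y) := by
  have h : Continuous (densityMat A) :=
    ((continuous_exp_matA A).matrix_trace.inv₀
      fun y => (trace_exp_pos (isSymm_matA hA y)).ne').smul (continuous_exp_matA A)
  exact (PiLp.continuous_toLp 2 _).comp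
    (continuous_pi fun i => (continuous_const.matrix_mul h).matrix_trace)

lemma continuous_logPart (hA : ∀ i, (A i)ᵀ = A i) (b : EuclideanSpace ℝ (Fin m)) :
    Continuous (logPart A b) :=
  ((continuous_exp_matA A).matrix_trace.log
    fun y => (trace_exp_pos (isSymm_matA hA y)).ne').sub (continuous_const.inner continuous_id)

lemma densityMat_mem_spectraplex (hA : ∀ i, (A i)ᵀ = A i) (y : EuclideanSpace ℝ (Fin m)) :
    densityMat A y ∈ spectraplex n := by
  have hs := isSymm_matA hA y
  have hpos := trace_exp_pos hs
  refine ⟨hs.exp.smul _, (posSemidef_exp hs).smul (inv_nonneg.2 hpos.le), ?_⟩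
  rw [densityMat, trace_smul, smul_eq_mul, inv_mul_cancel₀ hpos.ne']

/-- `Φ(z) - b` is a subgradient of `logPart A b` at `z`. -/
lemma logPart_add_inner_le (hA : ∀ i, (A i)ᵀ = A i) (b z w : EuclideanSpace ℝ (Fin m)) :
    logPart A b z + ⟪Amap A (densityMat A z) - b, w - z⟫ ≤ logPart A b w := by
  have h := (trace_smul_exp_le_log_trace_exp_sub (isSymm_matA hA w) (isSymm_matA hA z)).1
  rw [matA_sub, ← densityMat, ← inner_Amap] at h
  rw [logPart, logPart, inner_sub_left, inner_sub_right b]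
  linarith

lemma logPart_add_inner_lt (hA : ∀ i, (A i)ᵀ = A i)
    (hind : LinearIndependent ℝ
      (Fin.cons (1 : Matrix (Fin n) (Fin n) ℝ) A : Fin (m + 1) → Matrix (Fin n) (Fin n) ℝ))
    (b : EuclideanSpace ℝ (Fin m)) {z w : EuclideanSpace ℝ (Fin m)} (hne : z ≠ w) :
    logPart A b z + ⟪Amap A (densityMat A z) - b, w - z⟫ < logPart A b w := by
  refine lt_of_not_ge fun hge => hne ?_
  have h := (trace_smul_exp_le_log_trace_exp_sub (isSymm_matA hA w) (isSymm_matA hA z)).2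
  rw [matA_sub, ← densityMat, ← inner_Amap] at h
  rw [logPart, logPart, inner_sub_left, inner_sub_right b] at hge
  obtain ⟨c, hc⟩ := h (by linarith)
  have hzero := Fintype.linearIndependent_iff.1 hind
    (Fin.cons (-c) fun i => (w - z) i) (by
      rw [Fin.sum_univ_succ]
      simp only [Fin.cons_zero, Fin.cons_succ]
      rw [← matA, hc, neg_smul, neg_add_cancel])
  ext i
  have hi := hzero i.succ
  simp only [Fin.cons_succ, PiLp.sub_apply] at hi
  linarith

lemma mem_range_of_logPart_lt_on_sphere (hA : ∀ i, (A i)ᵀ = A i)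
    {b y₀ : EuclideanSpace ℝ (Fin m)} {R : ℝ} (hR : 0 < R)
    (h : ∀ w ∈ Metric.sphere y₀ R, logPart A b y₀ < logPart A b w) :
    b ∈ Set.range fun y => Amap A (densityMat A y) := by
  obtain ⟨z, hz, hmin⟩ := (isCompact_closedBall y₀ R).exists_isMinOn
    ⟨y₀, Metric.mem_closedBall_self hR.le⟩ (continuous_logPart hA b).continuousOn
  have hzR : z ∈ Metric.ball y₀ R := by
    refine Metric.mem_ball.2 (lt_of_le_of_ne (Metric.mem_closedBall.1 hz) fun heq => ?_)
    exact (h z heq).not_ge (hmin (Metric.mem_closedBall_self hR.le))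
  set v := b - Amap A (densityMat A z) with hv
  have hline : Continuous fun t : ℝ => z + t • v := by fun_prop
  have hlim : Tendsto (fun t : ℝ => ⟪Amap A (densityMat A (z + t • v)) - b, v⟫)
      (nhdsWithin 0 (Set.Ioi 0)) (nhds ⟪Amap A (densityMat A z) - b, v⟫) := by
    have hcont : Continuous fun t : ℝ => ⟪Amap A (densityMat A (z + t • v)) - b, v⟫ :=
      (((continuous_Amap_densityMat hA).comp hline).sub continuous_const).inner continuous_const
    have h0 := hcont.tendsto 0
    simp only [zero_smul, add_zero] at h0
    exact h0.mono_left nhdsWithin_le_nhds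
  have hball : ∀ᶠ t in nhds (0 : ℝ), z + t • v ∈ Metric.ball y₀ R :=
    hline.continuousAt.eventually_mem (Metric.isOpen_ball.mem_nhds (by simpa using hzR))
  have hnonneg : 0 ≤ ⟪Amap A (densityMat A z) - b, v⟫ := by
    refine ge_of_tendsto hlim ?_
    filter_upwards [hball.filter_mono nhdsWithin_le_nhds, self_mem_nhdsWithin] with t ht ht0
    have h1 := logPart_add_inner_le hA b (z + t • v) z
    have h2 : logPart A b z ≤ logPart A b (z + t • v) := hmin (Metric.ball_subset_closedBall ht)
    rw [sub_add_cancel_left, inner_neg_right, inner_smul_right] at h1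
    exact nonneg_of_mul_nonneg_right (by linarith) ht0
  refine ⟨z, ?_⟩
  rw [← neg_sub b, ← hv, inner_neg_left, real_inner_self_eq_norm_sq] at hnonneg
  have hv0 : ‖v‖ = 0 := by nlinarith [sq_nonneg ‖v‖]
  exact (sub_eq_zero.1 (norm_eq_zero.1 hv0)).symm

lemma isOpen_range_Amap_densityMat (hA : ∀ i, (A i)ᵀ = A i)
    (hind : LinearIndependent ℝ
      (Fin.cons (1 : Matrix (Fin n) (Fin n) ℝ) A : Fin (m + 1) → Matrix (Fin n) (Fin n) ℝ)) :
    IsOpen (Set.range fun y => Amap A (densityMat A y)) := by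
  rw [Metric.isOpen_iff]
  rintro _ ⟨y, rfl⟩
  dsimp only
  set c := Amap A (densityMat A y) with hc
  have hlt : ∀ w ∈ Metric.sphere y 1, 0 < logPart A c w - logPart A c y := by
    intro w hw
    have h := logPart_add_inner_lt hA hind c (Metric.ne_of_mem_sphere hw one_ne_zero).symm
    rw [← hc, sub_self, inner_zero_left] at h
    linarith
  obtain ⟨δ, hδ, hδle⟩ := (isCompact_sphere y 1).exists_forall_le' (a := 0)
    ((continuous_logPart hA c).sub continuous_const).continuousOn hlt
  refine ⟨δ, hδ, fun b hb => mem_range_of_logPart_lt_on_sphere hA (y₀ := y) one_pos fun w hw => ?_⟩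
  have h1 : δ ≤ logPart A c w - logPart A c y := hδle w hw
  have h2 : ⟪b - c, w - y⟫ < δ := by
    refine (real_inner_le_norm _ _).trans_lt ?_
    rw [← dist_eq_norm, ← dist_eq_norm, Metric.mem_sphere.1 hw, mul_one]
    exact hb
  rw [inner_sub_left, inner_sub_right, inner_sub_right] at h2
  simp only [logPart] at h1 ⊢
  linarith

lemma mul_norm_le_logPart (hA : ∀ i, (A i)ᵀ = A i) {b : EuclideanSpace ℝ (Fin m)} {ε : ℝ}
    (hε : 0 ≤ ε) (hb : Metric.closedBall b ε ⊆ momentBody A) (y : EuclideanSpace ℝ (Fin m)) :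
    ε * ‖y‖ ≤ logPart A b y := by
  have hmem : b + (ε * ‖y‖⁻¹) • y ∈ Metric.closedBall b ε := by
    rw [mem_closedBall_iff_norm, add_sub_cancel_left, norm_smul, norm_mul, norm_inv, norm_norm,
      Real.norm_of_nonneg hε, mul_assoc]
    exact mul_le_of_le_one_right hε inv_mul_le_one
  obtain ⟨X, ⟨-, hX, hX1⟩, hXb⟩ := hb hmem
  have h := trace_mul_le_log_trace_exp (isSymm_matA hA y) hX hX1
  rw [← inner_Amap, hXb, inner_add_left, real_inner_smul_left, real_inner_self_eq_norm_sq] at h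
  have hy : ε * ‖y‖⁻¹ * ‖y‖ ^ 2 = ε * ‖y‖ := by
    rcases eq_or_ne ‖y‖ 0 with h0 | h0
    · simp [h0]
    · field_simp
  rw [logPart]
  linarith

lemma interior_momentBody_subset_range (hA : ∀ i, (A i)ᵀ = A i) :
    interior (momentBody A) ⊆ Set.range fun y => Amap A (densityMat A y) := by
  intro b hb
  obtain ⟨ε, hε, hball⟩ := Metric.nhds_basis_closedBall.mem_iff.1 (mem_interior_iff_mem_nhds.1 hb)
  have hR : 0 < (|logPart A b 0| + 1) / ε := by positivity
  refine mem_range_of_logPart_lt_on_sphere hA (y₀ := 0) hR fun w hw => ?_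
  have h := mul_norm_le_logPart hA hε.le hball w
  rw [mem_sphere_zero_iff_norm.1 hw, mul_div_cancel₀ _ hε.ne'] at h
  linarith [le_abs_self (logPart A b 0)]

end MomentMap

/-- `y ↦ 𝒜(exp₁ A(y))` is a bijection from ℝ^m onto the interior
of the moment body. -/
theorem stmt6 (n m : ℕ) (hn : 1 ≤ n)
    (A : Fin m → Matrix (Fin n) (Fin n) ℝ) (hA : ∀ i, (A i)ᵀ = A i)
    (hind : LinearIndependent ℝ
      (Fin.cons (1 : Matrix (Fin n) (Fin n) ℝ) A : Fin (m + 1) → Matrix (Fin n) (Fin n) ℝ)) :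
    Function.Injective (fun y : EuclideanSpace ℝ (Fin m) => Amap A (densityMat A y)) ∧
    Set.range (fun y : EuclideanSpace ℝ (Fin m) => Amap A (densityMat A y)) =
      interior (momentBody A) := by
  have : Nonempty (Fin n) := ⟨⟨0, hn⟩⟩
  refine ⟨fun y z hyz => ?_, ?_⟩
  · by_contra hne
    dsimp only at hyz
    have h1 := logPart_add_inner_lt hA hind (Amap A (densityMat A y)) hne
    have h2 := logPart_add_inner_lt hA hind (Amap A (densityMat A y)) (Ne.symm hne)
    rw [sub_self, inner_zero_left] at h1
    rw [← hyz, sub_self, inner_zero_left] at h2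
    linarith
  · refine (interior_maximal ?_ (isOpen_range_Amap_densityMat hA hind)).antisymm
      (interior_momentBody_subset_range hA)
    rintro _ ⟨y, rfl⟩
    exact ⟨_, densityMat_mem_spectraplex hA y, rfl⟩
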